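/- Let A₁₀ = ℚ[g₄,g₆,h₆,k₆]/(g₆² + 2h₆² + k₆², 4g₄³ + 27h₆² + k₆²) and let σ be the ℚ-algebra involution of A₁₀ determined by σ(g₄) = g₄, σ(g₆) = g₆, σ(h₆) = −h₆, σ(k₆) = −k₆. Then the ℚ-algebra homomorphism ℚ[x,y,z] → A₁₀ given by x ↦ g₄, y ↦ g₆, z ↦ h₆k₆ sends 32x⁶ − 116x³y² + 27y⁴ + 625z² to 0 and induces a ℚ-algebra isomorphism ℚ[x,y,z]/(32x⁶ − 116x³y² + 27y⁴ + 625z²) ≅ A₁₀^σ, where A₁₀^σ is the subalgebra of σ-fixed elements of A₁₀. -/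

import Mathlib

open MvPolynomial

/-- The canonical ring `A₁₀ = ℚ[g₄,g₆,h₆,k₆]/(g₆² + 2h₆² + k₆², 4g₄³ + 27h₆² + k₆²)` of
the Shimura curve of discriminant 10; the variables `X 0, X 1, X 2, X 3` play the roles
of `g₄, g₆, h₆, k₆`. -/
noncomputable abbrev A10 : Type :=
  MvPolynomial (Fin 4) ℚ ⧸
    Ideal.span {(X 1 : MvPolynomial (Fin 4) ℚ) ^ 2 + 2 * X 2 ^ 2 + X 3 ^ 2,
      4 * (X 0 : MvPolynomial (Fin 4) ℚ) ^ 3 + 27 * X 2 ^ 2 + X 3 ^ 2}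

/-- The class of `g₄` in `A₁₀`. -/
noncomputable def g4 : A10 := Ideal.Quotient.mk _ (X 0)

/-- The class of `g₆` in `A₁₀`. -/
noncomputable def g6 : A10 := Ideal.Quotient.mk _ (X 1)

/-- The class of `h₆` in `A₁₀`. -/
noncomputable def h6 : A10 := Ideal.Quotient.mk _ (X 2)

/-- The class of `k₆` in `A₁₀`. -/
noncomputable def k6 : A10 := Ideal.Quotient.mk _ (X 3)

theorem g6_sq_add : g6 ^ 2 + 2 * h6 ^ 2 + k6 ^ 2 = 0 := by
  have h : (X 1 : MvPolynomial (Fin 4) ℚ) ^ 2 + 2 * X 2 ^ 2 + X 3 ^ 2 ∈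
      Ideal.span {(X 1 : MvPolynomial (Fin 4) ℚ) ^ 2 + 2 * X 2 ^ 2 + X 3 ^ 2,
        4 * (X 0 : MvPolynomial (Fin 4) ℚ) ^ 3 + 27 * X 2 ^ 2 + X 3 ^ 2} :=
    Ideal.subset_span (by simp)
  simpa only [g4, g6, h6, k6, map_add, map_mul, map_pow, map_ofNat] using
    Ideal.Quotient.eq_zero_iff_mem.mpr h

theorem g4_cube_add : 4 * g4 ^ 3 + 27 * h6 ^ 2 + k6 ^ 2 = 0 := by
  have h : 4 * (X 0 : MvPolynomial (Fin 4) ℚ) ^ 3 + 27 * X 2 ^ 2 + X 3 ^ 2 ∈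
      Ideal.span {(X 1 : MvPolynomial (Fin 4) ℚ) ^ 2 + 2 * X 2 ^ 2 + X 3 ^ 2,
        4 * (X 0 : MvPolynomial (Fin 4) ℚ) ^ 3 + 27 * X 2 ^ 2 + X 3 ^ 2} :=
    Ideal.subset_span (by simp)
  simpa only [g4, g6, h6, k6, map_add, map_mul, map_pow, map_ofNat] using
    Ideal.Quotient.eq_zero_iff_mem.mpr h

theorem algebraMap_A10_inv_mul : algebraMap ℚ A10 (1 / 25) * 25 = 1 := by
  rw [← map_ofNat (algebraMap ℚ A10) 25, ← map_mul]
  norm_num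

theorem h6_sq : h6 ^ 2 = algebraMap ℚ A10 (1 / 25) * (g6 ^ 2 - 4 * g4 ^ 3) := by
  linear_combination algebraMap ℚ A10 (1 / 25) * (g4_cube_add - g6_sq_add)
    - h6 ^ 2 * algebraMap_A10_inv_mul

theorem k6_sq : k6 ^ 2 = algebraMap ℚ A10 (1 / 25) * (8 * g4 ^ 3 - 27 * g6 ^ 2) := by
  linear_combination algebraMap ℚ A10 (1 / 25) * (27 * g6_sq_add - 2 * g4_cube_add)
    - k6 ^ 2 * algebraMap_A10_inv_mul

/-- `A₁₀` is generated by `1, h₆, k₆` as a module over any subalgebra containing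
`g₄, g₆, h₆k₆`. -/
theorem A10_exists_add_mul_h6_add_mul_k6 (S : Subalgebra ℚ A10)
    (hg4 : g4 ∈ S) (hg6 : g6 ∈ S) (hhk : h6 * k6 ∈ S) (a : A10) :
    ∃ b ∈ S, ∃ c ∈ S, ∃ d ∈ S, a = b + c * h6 + d * k6 := by
  have hh : h6 ^ 2 ∈ S := by
    rw [h6_sq]
    exact S.mul_mem (S.algebraMap_mem _) (S.sub_mem (S.pow_mem hg6 2)
      (S.mul_mem (ofNat_mem S 4) (S.pow_mem hg4 3)))
  have hk : k6 ^ 2 ∈ S := by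
    rw [k6_sq]
    exact S.mul_mem (S.algebraMap_mem _) (S.sub_mem
      (S.mul_mem (ofNat_mem S 8) (S.pow_mem hg4 3))
      (S.mul_mem (ofNat_mem S 27) (S.pow_mem hg6 2)))
  obtain ⟨p, rfl⟩ := Ideal.Quotient.mk_surjective a
  induction p using MvPolynomial.induction_on with
  | C r =>
    exact ⟨algebraMap ℚ A10 r, S.algebraMap_mem r, 0, S.zero_mem, 0, S.zero_mem, by
      simp only [zero_mul, add_zero]; rfl⟩
  | add p q hp hq =>
    obtain ⟨b, hb, c, hc, d, hd, h⟩ := hp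
    obtain ⟨b', hb', c', hc', d', hd', h'⟩ := hq
    exact ⟨b + b', S.add_mem hb hb', c + c', S.add_mem hc hc', d + d', S.add_mem hd hd', by
      rw [map_add, h, h']; ring⟩
  | mul_X p i hp =>
    obtain ⟨b, hb, c, hc, d, hd, h⟩ := hp
    rw [map_mul, h]
    fin_cases i
    · exact ⟨b * g4, S.mul_mem hb hg4, c * g4, S.mul_mem hc hg4, d * g4, S.mul_mem hd hg4, by
        change _ * g4 = _; ring⟩
    · exact ⟨b * g6, S.mul_mem hb hg6, c * g6, S.mul_mem hc hg6, d * g6, S.mul_mem hd hg6, by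
        change _ * g6 = _; ring⟩
    · exact ⟨c * h6 ^ 2 + d * (h6 * k6), S.add_mem (S.mul_mem hc hh) (S.mul_mem hd hhk),
        b, hb, 0, S.zero_mem, by change _ * h6 = _; ring⟩
    · exact ⟨c * (h6 * k6) + d * k6 ^ 2, S.add_mem (S.mul_mem hc hhk) (S.mul_mem hd hk),
        0, S.zero_mem, b, hb, by change _ * k6 = _; ring⟩

/-- Evaluation of `A₁₀` at a common zero of its two defining relations. -/
theorem A10_exists_algHom {K : Type*} [CommRing K] [Algebra ℚ K] (x y h k : K)
    (h₁ : y ^ 2 + 2 * h ^ 2 + k ^ 2 = 0) (h₂ : 4 * x ^ 3 + 27 * h ^ 2 + k ^ 2 = 0) :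
    ∃ φ : A10 →ₐ[ℚ] K, φ g4 = x ∧ φ g6 = y ∧ φ h6 = h ∧ φ k6 = k := by
  refine ⟨Ideal.Quotient.liftₐ _ (aeval ![x, y, h, k]) ?_, ?_, ?_, ?_, ?_⟩
  · intro a ha
    have hle : Ideal.span {(X 1 : MvPolynomial (Fin 4) ℚ) ^ 2 + 2 * X 2 ^ 2 + X 3 ^ 2,
        4 * (X 0 : MvPolynomial (Fin 4) ℚ) ^ 3 + 27 * X 2 ^ 2 + X 3 ^ 2} ≤
        RingHom.ker (aeval ![x, y, h, k] : MvPolynomial (Fin 4) ℚ →ₐ[ℚ] K) := by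
      rw [Ideal.span_le]
      rintro p (rfl | rfl)
      · simpa [RingHom.mem_ker] using h₁
      · simpa [RingHom.mem_ker] using h₂
    exact hle ha
  · exact (aeval_X _ _ : aeval ![x, y, h, k] (X 0 : MvPolynomial (Fin 4) ℚ) = _)
  · exact (aeval_X _ _ : aeval ![x, y, h, k] (X 1 : MvPolynomial (Fin 4) ℚ) = _)
  · exact (aeval_X _ _ : aeval ![x, y, h, k] (X 2 : MvPolynomial (Fin 4) ℚ) = _)
  · exact (aeval_X _ _ : aeval ![x, y, h, k] (X 3 : MvPolynomial (Fin 4) ℚ) = _)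

/-- The elements `1` and `h₆k₆` of `A₁₀` are linearly independent over `ℚ[g₄, g₆]`. -/
theorem eq_zero_of_aeval_add_aeval_mul_eq_zero (a b : MvPolynomial (Fin 2) ℚ)
    (hab : aeval ![g4, g6] a + aeval ![g4, g6] b * (h6 * k6) = 0) : a = 0 ∧ b = 0 := by
  let K := AlgebraicClosure (FractionRing (MvPolynomial (Fin 2) ℚ))
  let ι : MvPolynomial (Fin 2) ℚ →ₐ[ℚ] K := IsScalarTower.toAlgHom ℚ _ K
  have hι : Function.Injective ι := by
    change Function.Injective (algebraMap (MvPolynomial (Fin 2) ℚ) K)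
    rw [IsScalarTower.algebraMap_eq _ (FractionRing (MvPolynomial (Fin 2) ℚ)) K]
    exact (FaithfulSMul.algebraMap_injective (FractionRing (MvPolynomial (Fin 2) ℚ)) K).comp
      (IsFractionRing.injective _ _)
  obtain ⟨s, hs⟩ := IsAlgClosed.exists_pow_nat_eq
    ((ι (X 1) ^ 2 - 4 * ι (X 0) ^ 3) / 25) (n := 2) two_pos
  obtain ⟨t, ht⟩ := IsAlgClosed.exists_pow_nat_eq
    ((8 * ι (X 0) ^ 3 - 27 * ι (X 1) ^ 2) / 25) (n := 2) two_pos
  have hs0 : s ≠ 0 := by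
    rintro rfl
    have h : ι (X 1 ^ 2 - 4 * X 0 ^ 3) = ι 0 := by
      simp only [map_sub, map_mul, map_pow, map_ofNat, map_zero]
      linear_combination -25 * hs
    simpa using congrArg (aeval (![0, 1] : Fin 2 → ℚ)) (hι h)
  have ht0 : t ≠ 0 := by
    rintro rfl
    have h : ι (8 * X 0 ^ 3 - 27 * X 1 ^ 2) = ι 0 := by
      simp only [map_sub, map_mul, map_pow, map_ofNat, map_zero]
      linear_combination -25 * ht
    simpa using congrArg (aeval (![0, 1] : Fin 2 → ℚ)) (hι h)
  have key (r : K) (hr : r ^ 2 = s ^ 2) : ι a + ι b * (r * t) = 0 := by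
    obtain ⟨φ, hx, hy, hh, hk⟩ := A10_exists_algHom (ι (X 0)) (ι (X 1)) r t
      (by rw [hr, hs, ht]; ring) (by rw [hr, hs, ht]; ring)
    have hφ : φ.comp (aeval ![g4, g6]) = ι := by
      ext i
      fin_cases i
      · simpa using hx
      · simpa using hy
    have h := congrArg φ hab
    rw [map_add, map_mul, map_mul, hh, hk, map_zero] at h
    simpa only [← hφ, AlgHom.comp_apply] using h
  have h₁ := key s rfl
  have h₂ := key (-s) (neg_sq s)
  have ha : ι a = 0 := by linear_combination (h₁ + h₂) / 2
  have hb : ι b * (s * t) = 0 := by linear_combination (h₁ - h₂) / 2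
  exact ⟨(map_eq_zero_iff ι hι).mp ha, (map_eq_zero_iff ι hι).mp
    ((mul_eq_zero.mp hb).resolve_right (mul_ne_zero hs0 ht0))⟩

/-- Every polynomial in `x, y, z` is congruent to some `a(x, y) + b(x, y) z` modulo an ideal
containing a monic quadratic polynomial `z² - w(x, y)`. -/
theorem exists_sub_rename_add_rename_mul_mem {R : Type*} [CommRing R]
    (I : Ideal (MvPolynomial (Fin 3) R)) (w : MvPolynomial (Fin 2) R)
    (hw : X 2 ^ 2 - rename Fin.castSucc w ∈ I) (q : MvPolynomial (Fin 3) R) :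
    ∃ a b : MvPolynomial (Fin 2) R,
      q - (rename Fin.castSucc a + rename Fin.castSucc b * X 2) ∈ I := by
  induction q using MvPolynomial.induction_on with
  | C r => exact ⟨C r, 0, by simp⟩
  | add p q hp hq =>
    obtain ⟨a, b, h⟩ := hp
    obtain ⟨a', b', h'⟩ := hq
    refine ⟨a + a', b + b', ?_⟩
    convert I.add_mem h h' using 1
    simp only [map_add]
    ring
  | mul_X p i hp =>
    obtain ⟨a, b, h⟩ := hp
    induction i using Fin.lastCases with
    | last =>
      refine ⟨b * w, a, ?_⟩
      convert I.add_mem (I.mul_mem_right (X 2) h)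
        (I.mul_mem_left (rename Fin.castSucc b) hw) using 1
      rw [map_mul, show Fin.last 2 = 2 from rfl]
      ring
    | cast i =>
      refine ⟨a * X i, b * X i, ?_⟩
      convert I.mul_mem_right (X i.castSucc) h using 1
      simp only [map_mul, rename_X]
      ring

/-- if `σ` is the ℚ-algebra involution of `A₁₀` with `σ(g₄) = g₄`,
`σ(g₆) = g₆`, `σ(h₆) = −h₆`, `σ(k₆) = −k₆`, then the map `x ↦ g₄, y ↦ g₆, z ↦ h₆k₆`
kills `32x⁶ − 116x³y² + 27y⁴ + 625z²` and induces
`ℚ[x,y,z]/(32x⁶ − 116x³y² + 27y⁴ + 625z²) ≅ A₁₀^σ`. -/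
theorem stmt_14 (σ : A10 ≃ₐ[ℚ] A10)
    (hσg4 : σ g4 = g4) (hσg6 : σ g6 = g6) (hσh6 : σ h6 = -h6) (hσk6 : σ k6 = -k6) :
    aeval (![g4, g6, h6 * k6] : Fin 3 → A10)
        (32 * (X 0 : MvPolynomial (Fin 3) ℚ) ^ 6 - 116 * X 0 ^ 3 * X 1 ^ 2 +
          27 * X 1 ^ 4 + 625 * X 2 ^ 2) = 0 ∧
    ∃ ψ : (MvPolynomial (Fin 3) ℚ ⧸
            Ideal.span
              {32 * (X 0 : MvPolynomial (Fin 3) ℚ) ^ 6 - 116 * X 0 ^ 3 * X 1 ^ 2 +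
                27 * X 1 ^ 4 + 625 * X 2 ^ 2})
          ≃ₐ[ℚ] (AlgHom.equalizer (σ : A10 →ₐ[ℚ] A10) (AlgHom.id ℚ A10)),
      ∀ q : MvPolynomial (Fin 3) ℚ,
        (ψ (Ideal.Quotient.mk _ q) : A10) =
          aeval (![g4, g6, h6 * k6] : Fin 3 → A10) q := by
  set f : MvPolynomial (Fin 3) ℚ := 32 * X 0 ^ 6 - 116 * X 0 ^ 3 * X 1 ^ 2 +
    27 * X 1 ^ 4 + 625 * X 2 ^ 2 with hf
  set φ : MvPolynomial (Fin 3) ℚ →ₐ[ℚ] A10 := aeval ![g4, g6, h6 * k6] with hφ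
  have hφ0 : φ (X 0) = g4 := aeval_X _ _
  have hφ1 : φ (X 1) = g6 := aeval_X _ _
  have hφ2 : φ (X 2) = h6 * k6 := aeval_X _ _
  have hφf : φ f = 0 := by
    simp only [hf, map_add, map_sub, map_mul, map_pow, map_ofNat, hφ0, hφ1, hφ2]
    have hh : 25 * h6 ^ 2 = g6 ^ 2 - 4 * g4 ^ 3 := by
      linear_combination g4_cube_add - g6_sq_add
    have hk : 25 * k6 ^ 2 = 8 * g4 ^ 3 - 27 * g6 ^ 2 := by
      linear_combination 27 * g6_sq_add - 2 * g4_cube_add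
    linear_combination 25 * k6 ^ 2 * hh + (g6 ^ 2 - 4 * g4 ^ 3) * hk
  have hker (q : MvPolynomial (Fin 3) ℚ) (hq : q ∈ Ideal.span {f}) : φ q = 0 := by
    obtain ⟨c, rfl⟩ := Ideal.mem_span_singleton.mp hq
    rw [map_mul, hφf, zero_mul]
  have hker' (q : MvPolynomial (Fin 3) ℚ) (hq : φ q = 0) : q ∈ Ideal.span {f} := by
    have hw : X 2 ^ 2 - rename Fin.castSucc (C (-1 / 625) * (32 * X 0 ^ 6 -
        116 * X 0 ^ 3 * X 1 ^ 2 + 27 * X 1 ^ 4) : MvPolynomial (Fin 2) ℚ) ∈ Ideal.span {f} := by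
      refine Ideal.mem_span_singleton.mpr ⟨C (1 / 625), ?_⟩
      have hC : (C (1 / 625) : MvPolynomial (Fin 3) ℚ) * 625 = 1 := by
        rw [← map_ofNat C 625, ← map_mul]
        norm_num
      simp only [map_add, map_sub, map_mul, map_pow, map_ofNat, rename_X, rename_C, neg_div,
        map_neg, hf, Fin.castSucc_zero, Fin.castSucc_one]
      linear_combination -X 2 ^ 2 * hC
    obtain ⟨a, b, hab⟩ := exists_sub_rename_add_rename_mul_mem _ _ hw q
    have hcomp : (![g4, g6, h6 * k6] : Fin 3 → A10) ∘ Fin.castSucc = ![g4, g6] := by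
      ext i
      fin_cases i <;> rfl
    have h := hker _ hab
    rw [map_sub, hq, map_add, map_mul, hφ2, hφ, aeval_rename, aeval_rename, hcomp, zero_sub,
      neg_eq_zero] at h
    obtain ⟨rfl, rfl⟩ := eq_zero_of_aeval_add_aeval_mul_eq_zero a b h
    simpa using hab
  have hσφ (q : MvPolynomial (Fin 3) ℚ) : σ (φ q) = φ q := by
    have h : (σ : A10 →ₐ[ℚ] A10).comp φ = φ := by
      ext i
      fin_cases i
      · change σ (φ (X 0)) = φ (X 0)
        rw [hφ0, hσg4]
      · change σ (φ (X 1)) = φ (X 1)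
        rw [hφ1, hσg6]
      · change σ (φ (X 2)) = φ (X 2)
        rw [hφ2, map_mul, hσh6, hσk6]
        ring
    exact DFunLike.congr_fun h q
  have hfix (a : A10) (ha : σ a = a) : ∃ q, φ q = a := by
    obtain ⟨_, ⟨b, rfl⟩, _, ⟨c, rfl⟩, _, ⟨d, rfl⟩, h⟩ := A10_exists_add_mul_h6_add_mul_k6
      φ.range ⟨X 0, hφ0⟩ ⟨X 1, hφ1⟩ ⟨X 2, hφ2⟩ a
    refine ⟨b, ?_⟩
    change a = φ b + φ c * h6 + φ d * k6 at h
    have h' : a = φ b - φ c * h6 - φ d * k6 := by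
      conv_lhs => rw [← ha, h]
      simp only [map_add, map_mul, hσφ, hσh6, hσk6]
      ring
    have h2 : (2 : ℚ) • (φ b - a) = 0 := by
      rw [ofNat_smul_eq_nsmul ℚ, two_nsmul]
      linear_combination -h - h'
    exact sub_eq_zero.mp ((smul_eq_zero_iff_right two_ne_zero).mp h2)
  let φ' : MvPolynomial (Fin 3) ℚ →ₐ[ℚ] AlgHom.equalizer (σ : A10 →ₐ[ℚ] A10) (AlgHom.id ℚ A10) :=
    φ.codRestrict _ hσφ
  refine ⟨hφf, AlgEquiv.ofBijective
    (Ideal.Quotient.liftₐ _ φ' fun q hq => Subtype.ext (hker q hq)) ⟨?_, ?_⟩, fun q => rfl⟩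
  · rw [injective_iff_map_eq_zero]
    intro a ha
    obtain ⟨q, rfl⟩ := Ideal.Quotient.mk_surjective a
    exact Ideal.Quotient.eq_zero_iff_mem.mpr (hker' q (congrArg Subtype.val ha))
  · rintro ⟨a, ha⟩
    obtain ⟨q, hq⟩ := hfix a ha
    exact ⟨Ideal.Quotient.mk _ q, Subtype.ext hq⟩
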